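/- arXiv:2309.12518 — 6 statements merged into one kernel-verified Lean document; each statement's English description precedes it below -/
import Mathlib

section
/- For λ ∈ ℂ, let F_λ(x,y,z,u,v,w) = x·u² + y·v² + z·w² − λ·(x·v·w + y·u·w + z·u·v), the bihomogeneous equation of the divisor X_λ of bidegree (1,2) in ℙ²×ℙ². Then there exist (x,y,z) ∈ ℂ³ ∖ {0} and (u,v,w) ∈ ℂ³ ∖ {0} at which all six partial derivatives ∂F_λ/∂x, ∂F_λ/∂y, ∂F_λ/∂z, ∂F_λ/∂u, ∂F_λ/∂v, ∂F_λ/∂w vanish if and only if λ³ = 1. (Equivalently, the 3-fold X_λ ⊂ ℙ²×ℙ² is smooth if and only if λ³ ≠ 1.) -/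
/-- For `λ ∈ ℂ`, the divisor `X_λ = {x·u² + y·v² + z·w² = λ·(x·v·w + y·u·w + z·u·v)}`
of bidegree `(1,2)` in `ℙ²×ℙ²` has a singular point (a pair of nonzero vectors at which all
six partial derivatives of the bihomogeneous defining polynomial vanish) iff `λ³ = 1`. -/
theorem stmt_0 (l : ℂ) :
    (∃ x y z u v w : ℂ,
      ¬(x = 0 ∧ y = 0 ∧ z = 0) ∧ ¬(u = 0 ∧ v = 0 ∧ w = 0) ∧
      -- ∂F/∂x, ∂F/∂y, ∂F/∂z
      u ^ 2 - l * (v * w) = 0 ∧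
      v ^ 2 - l * (u * w) = 0 ∧
      w ^ 2 - l * (u * v) = 0 ∧
      -- ∂F/∂u, ∂F/∂v, ∂F/∂w
      2 * x * u - l * (y * w + z * v) = 0 ∧
      2 * y * v - l * (x * w + z * u) = 0 ∧
      2 * z * w - l * (x * v + y * u) = 0)
    ↔ l ^ 3 = 1 := by
  constructor
  · rintro ⟨-, -, -, u, v, w, -, huvw, hu, hv, hw, -⟩
    have hne : (u * v * w) ^ 2 ≠ 0 := by
      intro h
      apply huvw
      rcases mul_eq_zero.mp (pow_eq_zero_iff two_ne_zero |>.mp h) with h | rfl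
      · rcases mul_eq_zero.mp h with rfl | rfl <;> simp_all
      · simp_all
    refine mul_right_cancel₀ hne ?_
    calc l ^ 3 * (u * v * w) ^ 2 = (l * (v * w)) * (l * (u * w)) * (l * (u * v)) := by ring
      _ = u ^ 2 * v ^ 2 * w ^ 2 := by
        rw [← sub_eq_zero.mp hu, ← sub_eq_zero.mp hv, ← sub_eq_zero.mp hw]
      _ = 1 * (u * v * w) ^ 2 := by ring
  · intro h
    refine ⟨1, 1, l ^ 2, 1, 1, l ^ 2, by simp, by simp, ?_, ?_, ?_, ?_, ?_, ?_⟩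
    · linear_combination -h
    · linear_combination -h
    · linear_combination l * h
    · linear_combination -2 * h
    · linear_combination -2 * h
    · linear_combination 2 * l * h
end

section
/- For λ ∈ ℂ, let q₁ = x₀² + x₁² + λ(x₂² + x₃²) and q₂ = λ(x₀² − x₁²) + x₂² − x₃² in ℂ[x₀,x₁,x₂,x₃], defining the curve C_λ = {q₁ = q₂ = 0} ⊂ ℙ³. Then there exists a nonzero point (x₀,x₁,x₂,x₃) ∈ ℂ⁴ with q₁ = q₂ = 0 at which the 2×4 Jacobian matrix of (q₁,q₂) has rank at most 1 (i.e. all its 2×2 minors vanish) if and only if λ⁵ = λ, that is, λ ∈ {0, 1, −1, i, −i}. (Equivalently, C_λ is a smooth curve if and only if λ ∉ {0, ±1, ±i}.) -/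
/-- For `λ ∈ ℂ`, the curve `C_λ = {q₁ = q₂ = 0} ⊂ ℙ³`, with
`q₁ = x₀² + x₁² + λ(x₂² + x₃²)` and `q₂ = λ(x₀² − x₁²) + x₂² − x₃²`, has a point at which the
`2×4` Jacobian matrix of `(q₁, q₂)` has all `2×2` minors vanishing iff `λ⁵ = λ`. -/
theorem stmt_2 (l : ℂ) :
    (∃ x0 x1 x2 x3 : ℂ,
      ¬(x0 = 0 ∧ x1 = 0 ∧ x2 = 0 ∧ x3 = 0) ∧
      x0 ^ 2 + x1 ^ 2 + l * (x2 ^ 2 + x3 ^ 2) = 0 ∧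
      l * (x0 ^ 2 - x1 ^ 2) + x2 ^ 2 - x3 ^ 2 = 0 ∧
      ∀ i j : Fin 4,
        ![2 * x0, 2 * x1, 2 * l * x2, 2 * l * x3] i *
          ![2 * l * x0, -(2 * l * x1), 2 * x2, -(2 * x3)] j -
        ![2 * x0, 2 * x1, 2 * l * x2, 2 * l * x3] j *
          ![2 * l * x0, -(2 * l * x1), 2 * x2, -(2 * x3)] i = 0)
    ↔ l ^ 5 = l := by
  constructor
  · rintro ⟨x0, x1, x2, x3, hne, h1, h2, hJ⟩
    by_contra hl
    have hl0 : l ≠ 0 := by rintro rfl; simp at hl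
    have hm : 1 - l ^ 2 ≠ 0 := fun h => hl (by linear_combination (-l ^ 3 - l) * h)
    have hp : 1 + l ^ 2 ≠ 0 := fun h => hl (by linear_combination (l ^ 3 - l) * h)
    have h01 : x0 * x1 = 0 := by
      have h := hJ 0 1
      simp at h
      exact (mul_eq_zero.mp (show l * (x0 * x1) = 0 by
        linear_combination (-1 / 8) * h)).resolve_left hl0
    have h02 : x0 * x2 = 0 := by
      have h := hJ 0 2
      simp at h
      exact (mul_eq_zero.mp (show (1 - l ^ 2) * (x0 * x2) = 0 by
        linear_combination (1 / 4) * h)).resolve_left hm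
    have h03 : x0 * x3 = 0 := by
      have h := hJ 0 3
      simp at h
      exact (mul_eq_zero.mp (show (1 + l ^ 2) * (x0 * x3) = 0 by
        linear_combination (-1 / 4) * h)).resolve_left hp
    have h12 : x1 * x2 = 0 := by
      have h := hJ 1 2
      simp at h
      exact (mul_eq_zero.mp (show (1 + l ^ 2) * (x1 * x2) = 0 by
        linear_combination (1 / 4) * h)).resolve_left hp
    have h13 : x1 * x3 = 0 := by
      have h := hJ 1 3
      simp at h
      exact (mul_eq_zero.mp (show (1 - l ^ 2) * (x1 * x3) = 0 by
        linear_combination (-1 / 4) * h)).resolve_left hm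
    have h23 : x2 * x3 = 0 := by
      have h := hJ 2 3
      simp at h
      exact (mul_eq_zero.mp (show l * (x2 * x3) = 0 by
        linear_combination (-1 / 8) * h)).resolve_left hl0
    -- At most one coordinate is nonzero, and the quadrics then force it to vanish.
    have e0 : x0 = 0 := pow_eq_zero_iff (n := 4) (by norm_num) |>.mp (by
      linear_combination x0 ^ 2 * h1 - x0 * x1 * h01 - l * x0 * x2 * h02 - l * x0 * x3 * h03)
    have e1 : x1 = 0 := pow_eq_zero_iff (n := 4) (by norm_num) |>.mp (by
      linear_combination x1 ^ 2 * h1 - x0 * x1 * h01 - l * x1 * x2 * h12 - l * x1 * x3 * h13)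
    subst e0 e1
    have e2 : x2 = 0 := pow_eq_zero_iff (n := 4) (by norm_num) |>.mp (by
      linear_combination x2 ^ 2 * h2 + x2 * x3 * h23)
    subst e2
    exact hne ⟨rfl, rfl, rfl, pow_eq_zero_iff (n := 2) (by norm_num) |>.mp (by
      linear_combination -h2)⟩
  · intro hl
    obtain ⟨r, hr⟩ := IsAlgClosed.exists_pow_nat_eq (-l) (n := 2) (by norm_num)
    have hfac : l * ((1 - l ^ 2) * (1 + l ^ 2)) = 0 := by linear_combination -hl
    rcases mul_eq_zero.mp hfac with rfl | h
    · refine ⟨0, 0, 1, 1, by simp, by simp, by simp, fun i j => ?_⟩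
      fin_cases i <;> fin_cases j <;> simp
    rcases mul_eq_zero.mp h with h | h
    · refine ⟨r, 0, 1, 0, by simp, by linear_combination hr,
        by linear_combination l * hr + h, fun i j => ?_⟩
      fin_cases i <;> fin_cases j <;> simp
      · linear_combination 4 * r * h
      · linear_combination -4 * r * h
    · refine ⟨r, 0, 0, 1, by simp, by linear_combination hr,
        by linear_combination l * hr - h, fun i j => ?_⟩
      fin_cases i <;> fin_cases j <;> simp
      · linear_combination -4 * r * h
      · linear_combination 4 * r * h
end

section
/- For λ ∈ ℂ, let F_λ(u,v,x,y) = u·x²·(x + λy) − v·y²·(y + λx), the bihomogeneous equation of the curve C_λ ⊂ ℙ¹×ℙ¹ of bidegree (1,3). Then there exist (u,v) ∈ ℂ² ∖ {0} and (x,y) ∈ ℂ² ∖ {0} at which all four partial derivatives ∂F_λ/∂u, ∂F_λ/∂v, ∂F_λ/∂x, ∂F_λ/∂y vanish if and only if λ² = 1. (Equivalently, C_λ is smooth if and only if λ ≠ ±1.) -/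
/-- For `λ ∈ ℂ`, the bidegree `(1,3)` curve `C_λ = {u·x²·(x+λy) = v·y²·(y+λx)} ⊂ ℙ¹×ℙ¹` has a
singular point (a pair of nonzero vectors at which all four partial derivatives of the
bihomogeneous defining polynomial `F_λ = u·x²·(x+λy) − v·y²·(y+λx)` vanish) iff `λ² = 1`. -/
theorem stmt_4 (l : ℂ) :
    (∃ u v x y : ℂ,
      ¬(u = 0 ∧ v = 0) ∧ ¬(x = 0 ∧ y = 0) ∧
      -- ∂F/∂u, ∂F/∂v
      x ^ 2 * (x + l * y) = 0 ∧
      -(y ^ 2 * (y + l * x)) = 0 ∧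
      -- ∂F/∂x, ∂F/∂y
      u * (3 * x ^ 2 + 2 * l * x * y) - l * (v * y ^ 2) = 0 ∧
      l * (u * x ^ 2) - v * (3 * y ^ 2 + 2 * l * x * y) = 0)
    ↔ l ^ 2 = 1 := by
  constructor
  · rintro ⟨-, -, x, y, -, hxy, hu, hv, -, -⟩
    have hx : x ≠ 0 := by
      rintro rfl
      exact hxy ⟨rfl, by simpa using hv⟩
    have hy : y ≠ 0 := by
      rintro rfl
      exact hxy ⟨by simpa using hu, rfl⟩
    have h₁ : x + l * y = 0 := by simpa [hx] using hu
    have h₂ : y + l * x = 0 := (mul_eq_zero.1 (neg_eq_zero.1 hv)).resolve_left (pow_ne_zero 2 hy)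
    apply mul_right_cancel₀ hx
    linear_combination l * h₂ - h₁
  · intro h
    refine ⟨l, 1, -l, 1, by simp, by simp, by ring, ?_, ?_, ?_⟩
    · linear_combination h
    · linear_combination l * h
    · linear_combination (l ^ 2 + 3) * h
end

section
/- Let τ and τ_λ (λ ∈ ℂ*) be the automorphisms of ℙ³(ℂ) induced by (x₀,x₁,x₂,x₃) ↦ (x₃,x₂,x₁,x₀) and (x₀,x₁,x₂,x₃) ↦ (λx₀, λx₁, x₂, x₃), and let G be the group they generate. Suppose q is a nonzero quadratic form on ℂ⁴ that is not a product of two linear forms, and suppose the quadric surface S = {q = 0} ⊂ ℙ³(ℂ) is invariant (as a set) under G. Then either S = {x₀x₂ − x₁x₃ = 0}, or there exist a, b, c ∈ ℂ with a·b ≠ c² such that S = {a·x₀x₃ + b·x₁x₂ + c·(x₀x₂ + x₁x₃) = 0}. -/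
/-- A complex quadratic polynomial without zeros is constant. -/
lemma Complex.coeffs_eq_zero_of_quadratic_ne_zero {A B C : ℂ}
    (h : ∀ t : ℂ, A + t * B + t ^ 2 * C ≠ 0) : B = 0 ∧ C = 0 := by
  by_cases hC : C = 0
  · refine ⟨?_, hC⟩
    by_contra hB
    apply h (-A / B)
    subst hC
    field_simp
    ring
  · obtain ⟨s, hs⟩ := IsAlgClosed.exists_eq_mul_self (discrim C B A)
    obtain ⟨t, ht⟩ := exists_quadratic_eq_zero hC ⟨s, hs⟩
    exact absurd (by linear_combination ht) (h t)

/-- A complex binary quadratic form is a product of two linear forms. -/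
lemma Complex.exists_binary_quadratic_factorization (p r s : ℂ) :
    ∃ f₀ f₁ g₀ g₁ : ℂ, ∀ x y : ℂ,
      p * x ^ 2 + r * (x * y) + s * y ^ 2 = (f₀ * x + f₁ * y) * (g₀ * x + g₁ * y) := by
  by_cases hp : p = 0
  · exact ⟨0, 1, r, s, fun x y ↦ by subst hp; ring⟩
  · obtain ⟨z, hz⟩ := IsAlgClosed.exists_eq_mul_self (discrim p r s)
    obtain ⟨t, ht⟩ := exists_quadratic_eq_zero hp ⟨z, hz⟩
    refine ⟨p, -p * t, 1, t + r / p, fun x y ↦ ?_⟩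
    field_simp
    linear_combination y ^ 2 * ht

/-- If the vanishing of `α(x) + β(x, y) + γ(y)`, with `α`, `γ` binary quadratic forms and `β`
bilinear, forces the vanishing of `α(x)`, then either `α = 0` or `β = 0` and `γ = 0`. -/
lemma Complex.coeffs_eq_zero_of_forall_imp {p r s k m n a b c d : ℂ}
    (h : ∀ x₀ x₁ y₀ y₁ : ℂ,
      (p * x₀ ^ 2 + r * (x₀ * x₁) + s * x₁ ^ 2) +
        (a * (x₀ * y₁) + b * (x₁ * y₀) + c * (x₀ * y₀) + d * (x₁ * y₁)) +
        (k * y₀ ^ 2 + m * (y₀ * y₁) + n * y₁ ^ 2) = 0 →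
      p * x₀ ^ 2 + r * (x₀ * x₁) + s * x₁ ^ 2 = 0) :
    (p = 0 ∧ r = 0 ∧ s = 0) ∨
      ((a = 0 ∧ b = 0 ∧ c = 0 ∧ d = 0) ∧ k = 0 ∧ m = 0 ∧ n = 0) := by
  have key : ∀ x₀ x₁ : ℂ, p * x₀ ^ 2 + r * (x₀ * x₁) + s * x₁ ^ 2 ≠ 0 → ∀ y₀ y₁ : ℂ,
      a * (x₀ * y₁) + b * (x₁ * y₀) + c * (x₀ * y₀) + d * (x₁ * y₁) = 0 ∧
      k * y₀ ^ 2 + m * (y₀ * y₁) + n * y₁ ^ 2 = 0 := by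
    intro x₀ x₁ hx y₀ y₁
    refine Complex.coeffs_eq_zero_of_quadratic_ne_zero
      (A := p * x₀ ^ 2 + r * (x₀ * x₁) + s * x₁ ^ 2) fun t ht ↦ hx ?_
    exact h x₀ x₁ (t * y₀) (t * y₁) (by linear_combination ht)
  by_cases hα : ∀ x₀ x₁ : ℂ, p * x₀ ^ 2 + r * (x₀ * x₁) + s * x₁ ^ 2 = 0
  · left
    have h₁ := hα 1 0
    have h₂ := hα 0 1
    have h₃ := hα 1 1
    refine ⟨by linear_combination h₁, by linear_combination h₃ - h₁ - h₂,
      by linear_combination h₂⟩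
  · right
    push Not at hα
    obtain ⟨x₀, x₁, hx⟩ := hα
    have hβ : ∀ z₀ z₁ y₀ y₁ : ℂ,
        a * (z₀ * y₁) + b * (z₁ * y₀) + c * (z₀ * y₀) + d * (z₁ * y₁) = 0 := by
      intro z₀ z₁ y₀ y₁
      by_contra hz
      have hx0 := (key x₀ x₁ hx y₀ y₁).1
      have e₁ : p * z₀ ^ 2 + r * (z₀ * z₁) + s * z₁ ^ 2 = 0 := by
        by_contra hne
        exact hz (key _ _ hne y₀ y₁).1
      have e₂ : p * (x₀ + z₀) ^ 2 + r * ((x₀ + z₀) * (x₁ + z₁)) + s * (x₁ + z₁) ^ 2 = 0 := by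
        by_contra hne
        exact hz (by linear_combination (key _ _ hne y₀ y₁).1 - hx0)
      have e₃ : p * (x₀ - z₀) ^ 2 + r * ((x₀ - z₀) * (x₁ - z₁)) + s * (x₁ - z₁) ^ 2 = 0 := by
        by_contra hne
        exact hz (by linear_combination hx0 - (key _ _ hne y₀ y₁).1)
      exact hx (by linear_combination (e₂ + e₃) / 2 - e₁)
    have hγ := fun y₀ y₁ ↦ (key x₀ x₁ hx y₀ y₁).2
    have h₁ := hγ 1 0
    have h₂ := hγ 0 1
    have h₃ := hγ 1 1
    refine ⟨⟨by linear_combination hβ 1 0 0 1, by linear_combination hβ 0 1 1 0,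
      by linear_combination hβ 1 0 1 0, by linear_combination hβ 0 1 0 1⟩,
      by linear_combination h₁, by linear_combination h₃ - h₁ - h₂, by linear_combination h₂⟩

/-- The expansion of a quadratic form in four variables. -/
lemma QuadraticForm.exists_coeffs_fin_four (q : QuadraticForm ℂ (Fin 4 → ℂ)) :
    ∃ p r s k m n a b c d : ℂ, ∀ v : Fin 4 → ℂ, q v =
      (p * v 0 ^ 2 + r * (v 0 * v 1) + s * v 1 ^ 2) +
        (a * (v 0 * v 3) + b * (v 1 * v 2) + c * (v 0 * v 2) + d * (v 1 * v 3)) +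
        (k * v 2 ^ 2 + m * (v 2 * v 3) + n * v 3 ^ 2) := by
  let M := LinearMap.toMatrix₂' ℂ (QuadraticMap.associated (R := ℂ) q)
  refine ⟨M 0 0, M 0 1 + M 1 0, M 1 1, M 2 2, M 2 3 + M 3 2, M 3 3, M 0 3 + M 3 0,
    M 1 2 + M 2 1, M 0 2 + M 2 0, M 1 3 + M 3 1, fun v ↦ ?_⟩
  have h : q v = Matrix.toLinearMap₂' ℂ M v v := by
    simp only [M, Matrix.toLinearMap₂'_toMatrix', QuadraticMap.associated_eq_self_apply]
  rw [h, Matrix.toLinearMap₂'_apply]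
  simp only [Fin.sum_univ_four, smul_eq_mul]
  ring

theorem stmt_10 (q : QuadraticForm ℂ (Fin 4 → ℂ)) (hq : q ≠ 0)
    (hirr : ¬ ∃ f g : (Fin 4 → ℂ) →ₗ[ℂ] ℂ, ∀ v : Fin 4 → ℂ, q v = f v * g v)
    (hτ : ∀ v : Fin 4 → ℂ, q ![v 3, v 2, v 1, v 0] = 0 ↔ q v = 0)
    (hΓ : ∀ l : ℂ, l ≠ 0 → ∀ v : Fin 4 → ℂ,
      q ![l * v 0, l * v 1, v 2, v 3] = 0 ↔ q v = 0) :
    {v : Fin 4 → ℂ | q v = 0} = {v : Fin 4 → ℂ | v 0 * v 2 - v 1 * v 3 = 0} ∨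
    ∃ a b c : ℂ, a * b ≠ c ^ 2 ∧
      {v : Fin 4 → ℂ | q v = 0} =
        {v : Fin 4 → ℂ |
          a * (v 0 * v 3) + b * (v 1 * v 2) + c * (v 0 * v 2 + v 1 * v 3) = 0} := by
  obtain ⟨p, r, s, k, m, n, a, b, c, d, hqv⟩ := q.exists_coeffs_fin_four
  have hlin (i j : Fin 4) (f₀ f₁ g₀ g₁ : ℂ) :
      ¬ ∀ v : Fin 4 → ℂ, q v = (f₀ * v i + f₁ * v j) * (g₀ * v i + g₁ * v j) := fun h ↦
    hirr ⟨f₀ • LinearMap.proj i + f₁ • LinearMap.proj j,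
      g₀ • LinearMap.proj i + g₁ • LinearMap.proj j, fun v ↦ by simp [h v]⟩
  have hvanish : ∀ v : Fin 4 → ℂ, q v = 0 →
      p * v 0 ^ 2 + r * (v 0 * v 1) + s * v 1 ^ 2 = 0 ∧
      k * v 2 ^ 2 + m * (v 2 * v 3) + n * v 3 ^ 2 = 0 := by
    intro v hv
    have h₁ := (hΓ (-1) (by norm_num) v).2 hv
    have h₂ := (hΓ 2 (by norm_num) v).2 hv
    simp only [hqv, Matrix.cons_val] at hv h₁ h₂
    constructor
    · linear_combination -hv / 2 + h₁ / 6 + h₂ / 3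
    · linear_combination hv + h₁ / 3 - h₂ / 3
  obtain ⟨rfl, rfl, rfl⟩ : p = 0 ∧ r = 0 ∧ s = 0 := by
    refine (Complex.coeffs_eq_zero_of_forall_imp (k := k) (m := m) (n := n) (a := a) (b := b)
      (c := c) (d := d) fun x₀ x₁ y₀ y₁ h ↦ ?_).resolve_right ?_
    · simpa using (hvanish ![x₀, x₁, y₀, y₁] (by simpa [hqv] using h)).1
    · rintro ⟨⟨rfl, rfl, rfl, rfl⟩, rfl, rfl, rfl⟩
      obtain ⟨f₀, f₁, g₀, g₁, h⟩ := Complex.exists_binary_quadratic_factorization p r s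
      exact hlin 0 1 f₀ f₁ g₀ g₁ fun v ↦ by rw [hqv, ← h]; ring
  obtain ⟨rfl, rfl, rfl⟩ : k = 0 ∧ m = 0 ∧ n = 0 := by
    refine (Complex.coeffs_eq_zero_of_forall_imp (k := 0) (m := 0) (n := 0) (a := b) (b := a)
      (c := c) (d := d) fun x₀ x₁ y₀ y₁ h ↦ ?_).resolve_right ?_
    · have := (hvanish ![y₀, y₁, x₀, x₁] (by
        simp only [hqv, Matrix.cons_val]
        linear_combination h)).2
      simpa using this
    · rintro ⟨⟨rfl, rfl, rfl, rfl⟩, -⟩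
      obtain ⟨f₀, f₁, g₀, g₁, h⟩ := Complex.exists_binary_quadratic_factorization k m n
      exact hlin 2 3 f₀ f₁ g₀ g₁ fun v ↦ by rw [hqv, ← h]; ring
  replace hqv : ∀ v : Fin 4 → ℂ, q v =
      a * (v 0 * v 3) + b * (v 1 * v 2) + c * (v 0 * v 2) + d * (v 1 * v 3) := fun v ↦ by
    rw [hqv]; ring
  by_cases hcd : c = d
  · subst hcd
    refine Or.inr ⟨a, b, c, fun hab ↦ hirr ?_, ?_⟩
    · by_cases ha : a = 0
      · have hc : c = 0 := by simpa [ha] using hab.symm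
        exact ⟨b • LinearMap.proj 1, LinearMap.proj 2, fun v ↦ by simp [hqv, ha, hc]; ring⟩
      · refine ⟨a • LinearMap.proj 0 + c • LinearMap.proj 1,
          LinearMap.proj 3 + (c / a) • LinearMap.proj 2, fun v ↦ ?_⟩
        simp only [hqv, LinearMap.add_apply, LinearMap.smul_apply, LinearMap.proj_apply,
          smul_eq_mul]
        field_simp
        linear_combination v 1 * v 2 * hab
    · ext v
      simp only [Set.mem_ofPred_eq, hqv]
      ring_nf
  · left
    have hsub : ∀ v : Fin 4 → ℂ, q v = 0 → v 0 * v 2 - v 1 * v 3 = 0 := by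
      intro v hv
      have h := (hτ v).2 hv
      simp only [hqv, Matrix.cons_val] at hv h
      refine (mul_eq_zero.1 ?_).resolve_left (sub_ne_zero.2 hcd)
      linear_combination hv - h
    have hpt : ∀ x₀ x₁ : ℂ, a * x₀ ^ 2 + (c + d) * (x₀ * x₁) + b * x₁ ^ 2 = 0 := by
      intro x₀ x₁
      have h := hsub ![x₀, x₁, -(a * x₀ + d * x₁), b * x₁ + c * x₀] (by
        simp only [hqv, Matrix.cons_val]; ring)
      simp only [Matrix.cons_val] at h
      linear_combination -h
    have ha : a = 0 := by linear_combination hpt 1 0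
    have hb : b = 0 := by linear_combination hpt 0 1
    have hd : d = -c := by linear_combination hpt 1 1 - ha - hb
    have hc : c ≠ 0 := fun h ↦ hcd (by rw [hd, h, neg_zero])
    ext v
    refine ⟨hsub v, fun hv ↦ ?_⟩
    simp only [Set.mem_ofPred_eq, hqv, ha, hb, hd] at hv ⊢
    linear_combination c * hv
end

section
/- Fix a, b ∈ ℂ with a ≠ 0. For all (x₁,x₂,x₃,y₁,y₂,y₃,z₁,z₂,z₃) ∈ ℂ⁹, if Pf₁ = Pf₂ = Pf₃ = 0 at this point, then also Pf₄ = 0 and Pf₅ = 0, where Pf₁ = (b−a)x₂y₃ − (b+a)x₃y₂ − 2a·x₁y₁, Pf₂ = (b−a)y₂z₃ − (b+a)y₃z₂ − 2a·y₁z₁, Pf₃ = (b−a)x₂z₃ − (b+a)x₃z₂ + 2a·x₁z₁, Pf₄ = b(x₁y₁z₃ + x₁y₃z₁ + x₃y₁z₁ + x₃y₂z₃), Pf₅ = x₁y₁z₂ + x₁y₂z₁ + x₂y₁z₁ + x₂y₃z₂. (Thus for a ≠ 0 the vanishing locus of the five Pfaffians equals the complete intersection defined by Pf₁, Pf₂,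 Pf₃.) -/
/-- Fix `a, b ∈ ℂ` with `a ≠ 0`. At any point of `ℂ⁹` where `Pf₁ = Pf₂ = Pf₃ = 0`, also
`Pf₄ = 0` and `Pf₅ = 0`. -/
theorem stmt_17 (a b : ℂ) (ha : a ≠ 0)
    (x1 x2 x3 y1 y2 y3 z1 z2 z3 : ℂ)
    (h1 : (b - a) * (x2 * y3) - (b + a) * (x3 * y2) - 2 * a * (x1 * y1) = 0)
    (h2 : (b - a) * (y2 * z3) - (b + a) * (y3 * z2) - 2 * a * (y1 * z1) = 0)
    (h3 : (b - a) * (x2 * z3) - (b + a) * (x3 * z2) + 2 * a * (x1 * z1) = 0) :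
    b * (x1 * y1 * z3 + x1 * y3 * z1 + x3 * y1 * z1 + x3 * y2 * z3) = 0 ∧
    x1 * y1 * z2 + x1 * y2 * z1 + x2 * y1 * z1 + x2 * y3 * z2 = 0 := by
  have h2a : -2 * a ≠ 0 := mul_ne_zero (by norm_num) ha
  constructor
  · refine mul_eq_zero_of_right b (mul_left_cancel₀ h2a ?_)
    linear_combination z3 * h1 + x3 * h2 - y3 * h3
  · refine mul_left_cancel₀ h2a ?_
    linear_combination z2 * h1 + x2 * h2 - y2 * h3
end

section
/- Let Q = {x·y + y·z + x·z + t·w = 0} ⊂ ℙ⁴(ℂ) with homogeneous coordinates [x:y:z:t:w]. Consider the automorphisms of ℙ⁴ given by: permutations of the coordinates x, y, z; the scalings s_λ: (x,y,z,t,w) ↦ (λx, λy, λz, λ²t, w) for λ ∈ ℂ*; and the involution ι: (x,y,z,t,w) ↦ (x,y,z,w,t). Then no point of Q is fixed simultaneously by all of these automorphisms; that is, the quadric Q contains no G-invariant point. -/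
/-- No point of the quadric `Q = {x·y + y·z + x·z + t·w = 0} ⊂ ℙ⁴(ℂ)` (given by a nonzero
vector `((x,y,z),t,w)` of homogeneous coordinates) is fixed simultaneously by all
permutations of the coordinates `x, y, z`, by all scalings
`s_λ : (x,y,z,t,w) ↦ (λx,λy,λz,λ²t,w)` for `λ ∈ ℂ*`, and by the involution
`ι : (x,y,z,t,w) ↦ (x,y,z,w,t)`. -/
theorem stmt_19 :
    ¬ ∃ (v : Fin 3 → ℂ) (t w : ℂ),
      ¬(v = 0 ∧ t = 0 ∧ w = 0) ∧
      v 0 * v 1 + v 1 * v 2 + v 0 * v 2 + t * w = 0 ∧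
      -- fixed by every permutation of x, y, z
      (∀ σ : Equiv.Perm (Fin 3),
        ∃ c : ℂ, c ≠ 0 ∧ (∀ i, v (σ i) = c * v i) ∧ t = c * t ∧ w = c * w) ∧
      -- fixed by every scaling s_λ
      (∀ l : ℂ, l ≠ 0 →
        ∃ c : ℂ, c ≠ 0 ∧ (∀ i, l * v i = c * v i) ∧ l ^ 2 * t = c * t ∧ w = c * w) ∧
      -- fixed by the involution ι
      (∃ c : ℂ, c ≠ 0 ∧ (∀ i, v i = c * v i) ∧ w = c * t ∧ t = c * w) := by
  rintro ⟨v, t, w, hne, hQ, hperm, hscale, e, he, -, hwt, htw⟩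
  have ht : t = 0 := by
    obtain ⟨c, -, -, h₁, h₂⟩ := hscale 2 two_ne_zero
    by_contra h
    have hw : w ≠ 0 := hwt ▸ mul_ne_zero he h
    have hc : c = 1 := mul_right_cancel₀ hw (by rw [one_mul, ← h₂])
    subst hc
    exact h (by linear_combination h₁ / 3)
  have hw : w = 0 := by rw [hwt, ht, mul_zero]
  obtain ⟨c, -, hc, -, -⟩ := hperm (Equiv.swap 0 1)
  obtain ⟨d, -, hd, -, -⟩ := hperm (Equiv.swap 1 2)
  have hc0 : v 1 = c * v 0 := by simpa using hc 0
  have hc2 : v 2 = c * v 2 := hc 2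
  have hd1 : v 2 = d * v 1 := by simpa using hd 1
  have hd2 : v 1 = d * v 2 := by simpa using hd 2
  have hv2 : v 2 ≠ 0 := by
    intro h2
    have h1 : v 1 = 0 := by rw [hd2, h2, mul_zero]
    have h0 : v 0 = 0 := by
      have : v 0 = c * v 1 := by simpa using hc 1
      rw [this, h1, mul_zero]
    exact hne ⟨by ext i; fin_cases i <;> assumption, ht, hw⟩
  have hc1 : c = 1 := mul_right_cancel₀ hv2 (by rw [one_mul, ← hc2])
  have hv1 : v 1 ≠ 0 := fun h => hv2 (by rw [hd1, h, mul_zero])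
  have h01 : v 1 = v 0 := by rw [hc0, hc1, one_mul]
  have hd0 : v 0 = d * v 0 := hd 0
  have hd_one : d = 1 := mul_right_cancel₀ (h01 ▸ hv1) (by rw [one_mul, ← hd0])
  have h12 : v 2 = v 1 := by rw [hd1, hd_one, one_mul]
  rw [ht, h12, ← h01] at hQ
  exact hv1 (pow_eq_zero_iff two_ne_zero |>.mp (by linear_combination hQ / 3))
end
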